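/- arXiv:1102.1173 — 2 statements merged into one kernel-verified Lean document; each statement's English description precedes it below -/
import Mathlib

section
/- For every parameter vector η ∈ ℝ^n with all components positive and every i = 1, …, n, the one-sided partial derivatives are one-sidedly continuous along the i-th direction: ∂_i⁻F(η) = lim_{h→0⁺} ∂_i⁻F(η − h e_i) and ∂_i⁺F(η) = lim_{h→0⁺} ∂_i⁺F(η + h e_i). -/
open Filter Set Topology

/-- The value function `F(η) = inf_{x ∈ Q} (φ(x) + Σ_i η_i ψ_i(x))` of
multi-parameter Tikhonov regularization. -/
noncomputable def valueFun {X : Type*} {n : ℕ} (Q : Set X) (φ : X → ℝ)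
    (ψ : Fin n → X → ℝ) (η : Fin n → ℝ) : ℝ :=
  sInf ((fun x => φ x + ∑ i, η i * ψ i x) '' Q)

/-- `HasDPlus F η i D` says that the right-sided partial derivative
`∂_i⁺F(η) = lim_{h→0⁺} (F(η + h eᵢ) - F(η))/h` exists and equals `D`. -/
def HasDPlus {n : ℕ} (F : (Fin n → ℝ) → ℝ) (η : Fin n → ℝ) (i : Fin n) (D : ℝ) : Prop :=
  Filter.Tendsto (fun h : ℝ => (F (η + h • (Pi.single i 1 : Fin n → ℝ)) - F η) / h)
    (nhdsWithin 0 (Set.Ioi 0)) (nhds D)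

/-- `HasDMinus F η i D` says that the left-sided partial derivative
`∂_i⁻F(η) = lim_{h→0⁺} (F(η) - F(η - h eᵢ))/h` exists and equals `D`. -/
def HasDMinus {n : ℕ} (F : (Fin n → ℝ) → ℝ) (η : Fin n → ℝ) (i : Fin n) (D : ℝ) : Prop :=
  Filter.Tendsto (fun h : ℝ => (F η - F (η - h • (Pi.single i 1 : Fin n → ℝ))) / h)
    (nhdsWithin 0 (Set.Ioi 0)) (nhds D)

/-- The right derivative of a concave function is continuous from the right. -/
theorem ConcaveOn.tendsto_hasDerivWithinAt_Ioi {f g : ℝ → ℝ} {a b D : ℝ} (hab : a < b)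
    (hf : ConcaveOn ℝ (Ico a b) f) (hD : HasDerivWithinAt f D (Ioi a) a)
    (hg : ∀ x ∈ Ioo a b, HasDerivWithinAt f (g x) (Ioi x) x) :
    Tendsto g (𝓝[>] a) (𝓝 D) := by
  have hslope : Tendsto (slope f a) (𝓝[>] a) (𝓝 D) :=
    (hasDerivWithinAt_iff_tendsto_slope' self_notMem_Ioi).1 hD
  have ha : a ∈ Ico a b := left_mem_Ico.2 hab
  refine tendsto_order.2 ⟨fun c hc => ?_, fun c hc => ?_⟩
  · obtain ⟨y, hcy, hy⟩ :=
      ((hslope.eventually_const_lt hc).and (Ioo_mem_nhdsGT hab)).exists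
    have hcont : Tendsto (fun x => slope f x y) (𝓝[>] a) (𝓝 (slope f a y)) := by
      simp only [slope_def_field]
      refine (tendsto_const_nhds.sub hD.continuousWithinAt).div
        (tendsto_const_nhds.sub (tendsto_id.mono_left nhdsWithin_le_nhds)) ?_
      exact sub_ne_zero.2 hy.1.ne'
    filter_upwards [hcont.eventually_const_lt hcy, Ioo_mem_nhdsGT hy.1] with x hcx hx
    have hxb : x < b := hx.2.trans hy.2
    exact hcx.trans_le (hf.slope_le_of_hasDerivWithinAt_Ioi ⟨hx.1.le, hxb⟩ ⟨hy.1.le, hy.2⟩ hx.2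
      (hg x ⟨hx.1, hxb⟩))
  · filter_upwards [Ioo_mem_nhdsGT hab] with x hx
    refine lt_of_le_of_lt ?_ hc
    have hxD : slope f a x ≤ D :=
      hf.slope_le_of_hasDerivWithinAt_Ioi ha ⟨hx.1.le, hx.2⟩ hx.1 hD
    have hgx : g x ≤ slope f a x := by
      refine le_of_tendsto
        ((hasDerivWithinAt_iff_tendsto_slope' self_notMem_Ioi).1 (hg x hx)) ?_
      filter_upwards [Ioo_mem_nhdsGT hx.2] with z hz
      simpa only [slope_def_field] using
        hf.slope_anti_adjacent ha ⟨(hx.1.trans hz.1).le, hz.2⟩ hx.1 hz.1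
    exact hgx.trans hxD

/-- A right directional derivative is a right derivative along the line. -/
theorem hasDerivWithinAt_Ioi_of_tendsto_line {E : Type*} [AddCommGroup E] [Module ℝ E]
    {F : E → ℝ} {x v : E} {t D : ℝ}
    (h : Tendsto (fun k : ℝ => (F (x + t • v + k • v) - F (x + t • v)) / k) (𝓝[>] 0) (𝓝 D)) :
    HasDerivWithinAt (fun s : ℝ => F (x + s • v)) D (Ioi t) t := by
  rw [hasDerivWithinAt_iff_tendsto_slope' self_notMem_Ioi]
  have hshift : Tendsto (fun s : ℝ => s - t) (𝓝[>] t) (𝓝[>] 0) := by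
    refine tendsto_nhdsWithin_iff.2 ⟨?_, ?_⟩
    · have : Tendsto (fun s : ℝ => s - t) (𝓝 t) (𝓝 (t - t)) := tendsto_id.sub_const t
      rw [sub_self] at this
      exact this.mono_left nhdsWithin_le_nhds
    · filter_upwards [self_mem_nhdsWithin] with s hs using sub_pos.2 (mem_Ioi.1 hs)
  refine (h.comp hshift).congr fun s => ?_
  simp only [Function.comp_apply, slope_def_field, add_assoc, ← add_smul, add_sub_cancel]

/-- The one-sided directional derivative of a concave function is one-sidedly continuous along
its direction. -/
theorem ConcaveOn.tendsto_directional_deriv {E : Type*} [AddCommGroup E] [Module ℝ E]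
    {F : E → ℝ} {S : Set E} (hF : ConcaveOn ℝ S F) {x v : E} {b D : ℝ} {g : ℝ → ℝ} (hb : 0 < b)
    (hS : ∀ t ∈ Ico 0 b, x + t • v ∈ S)
    (hD : Tendsto (fun k : ℝ => (F (x + k • v) - F x) / k) (𝓝[>] 0) (𝓝 D))
    (hg : ∀ t ∈ Ioo 0 b,
      Tendsto (fun k : ℝ => (F (x + t • v + k • v) - F (x + t • v)) / k) (𝓝[>] 0) (𝓝 (g t))) :
    Tendsto g (𝓝[>] 0) (𝓝 D) := by
  have hline : ConcaveOn ℝ (Ico 0 b) fun t : ℝ => F (x + t • v) := by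
    refine ⟨convex_Ico 0 b, fun s hs t ht p q hp hq hpq => ?_⟩
    have hcomb : x + (p • s + q • t) • v = p • (x + s • v) + q • (x + t • v) := by
      obtain rfl : q = 1 - p := by linarith
      simp only [smul_eq_mul]
      module
    simpa only [hcomb] using hF.2 (hS s hs) (hS t ht) hp hq hpq
  refine hline.tendsto_hasDerivWithinAt_Ioi hb ?_ fun t ht =>
    hasDerivWithinAt_Ioi_of_tendsto_line (hg t ht)
  exact hasDerivWithinAt_Ioi_of_tendsto_line (by simpa only [zero_smul, add_zero] using hD)

theorem concaveOn_valueFun {X : Type*} {n : ℕ} {Q : Set X} (hQ : Q.Nonempty)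
    {φ : X → ℝ} (hφ : ∀ x, 0 ≤ φ x) {ψ : Fin n → X → ℝ} (hψ : ∀ i x, 0 ≤ ψ i x) :
    ConcaveOn ℝ (Ici 0) (valueFun Q φ ψ) := by
  have hle : ∀ η ∈ Ici (0 : Fin n → ℝ), ∀ x ∈ Q,
      valueFun Q φ ψ η ≤ φ x + ∑ i, η i * ψ i x := by
    refine fun η hη x hx => csInf_le ⟨0, ?_⟩ (mem_image_of_mem _ hx)
    rintro _ ⟨y, -, rfl⟩
    exact add_nonneg (hφ y) (Finset.sum_nonneg fun i _ => mul_nonneg (hη i) (hψ i y))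
  refine ⟨convex_Ici 0, fun η hη θ hθ p q hp hq hpq => le_csInf (hQ.image _) ?_⟩
  rintro _ ⟨x, hx, rfl⟩
  calc p • valueFun Q φ ψ η + q • valueFun Q φ ψ θ
      ≤ p * (φ x + ∑ i, η i * ψ i x) + q * (φ x + ∑ i, θ i * ψ i x) :=
        add_le_add (mul_le_mul_of_nonneg_left (hle η hη x hx) hp)
          (mul_le_mul_of_nonneg_left (hle θ hθ x hx) hq)
    _ = (p + q) * φ x + ∑ i, (p • η + q • θ) i * ψ i x := by
        simp only [Pi.add_apply, Pi.smul_apply, smul_eq_mul, add_mul, mul_add,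
          Finset.sum_add_distrib, Finset.mul_sum, mul_assoc]
        ring
    _ = φ x + ∑ i, (p • η + q • θ) i * ψ i x := by rw [hpq, one_mul]

theorem HasDMinus.tendsto_neg_single {n : ℕ} {F : (Fin n → ℝ) → ℝ} {η : Fin n → ℝ} {i : Fin n}
    {D : ℝ} (h : HasDMinus F η i D) :
    Tendsto (fun k : ℝ => (F (η + k • -(Pi.single i 1 : Fin n → ℝ)) - F η) / k)
      (𝓝[>] 0) (𝓝 (-D)) := by
  refine (Tendsto.neg h).congr fun k => ?_
  rw [smul_neg, ← sub_eq_add_neg, ← neg_div, neg_sub]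

/-- one-sided continuity of the one-sided partial derivatives along the
`i`-th direction: `∂_i⁻F(η) = lim_{h→0⁺} ∂_i⁻F(η − h eᵢ)` and
`∂_i⁺F(η) = lim_{h→0⁺} ∂_i⁺F(η + h eᵢ)`. -/
theorem one_sided_derivatives_one_sided_continuity {X : Type*} {n : ℕ}
    (Q : Set X) (hQ : Q.Nonempty)
    (φ : X → ℝ) (hφ : ∀ x, 0 ≤ φ x)
    (ψ : Fin n → X → ℝ) (hψ : ∀ i x, 0 ≤ ψ i x)
    (η : Fin n → ℝ) (hη : ∀ i, 0 < η i) (i : Fin n)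
    (Dm Dp : ℝ)
    (hDm : HasDMinus (valueFun Q φ ψ) η i Dm)
    (hDp : HasDPlus (valueFun Q φ ψ) η i Dp)
    (gm gp : ℝ → ℝ)
    (hgm : ∀ h : ℝ, 0 < h → h < η i →
      HasDMinus (valueFun Q φ ψ) (η - h • (Pi.single i 1 : Fin n → ℝ)) i (gm h))
    (hgp : ∀ h : ℝ, 0 < h →
      HasDPlus (valueFun Q φ ψ) (η + h • (Pi.single i 1 : Fin n → ℝ)) i (gp h)) :
    Filter.Tendsto gm (nhdsWithin 0 (Set.Ioi 0)) (nhds Dm) ∧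
    Filter.Tendsto gp (nhdsWithin 0 (Set.Ioi 0)) (nhds Dp) := by
  have hF := concaveOn_valueFun hQ hφ hψ
  constructor
  · have hneg : Tendsto (fun h => -gm h) (𝓝[>] 0) (𝓝 (-Dm)) := by
      refine hF.tendsto_directional_deriv (x := η) (v := -Pi.single i 1) (hη i)
        (fun t ht j => ?_) hDm.tendsto_neg_single fun t ht => ?_
      · obtain rfl | hj := eq_or_ne j i
        · simpa using ht.2.le
        · simpa [hj] using (hη j).le
      · simpa only [smul_neg, ← sub_eq_add_neg] using (hgm t ht.1 ht.2).tendsto_neg_single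
    simpa only [neg_neg] using hneg.neg
  · refine hF.tendsto_directional_deriv (x := η) (v := Pi.single i 1) one_pos
      (fun t ht => ?_) hDp fun t ht => hgp t ht.1
    have hsingle : (0 : Fin n → ℝ) ≤ Pi.single i 1 := Pi.single_nonneg.2 zero_le_one
    exact add_nonneg (fun j => (hη j).le) (smul_nonneg ht.1 hsingle)
end

section
/- As η tends to 0 within the positive orthant of ℝ^n, the value function satisfies F(η) → inf_{x ∈ Q_ad} φ(x), and for each i = 1, …, n both η_i ∂_i⁻F(η) → 0 and η_i ∂_i⁺F(η) → 0. -/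
open Filter Set Topology

section ValueFun

variable {X : Type*} {n : ℕ} {Q : Set X} {φ : X → ℝ} {ψ : Fin n → X → ℝ}

theorem sInf_fidelity_le (hφ : ∀ x, 0 ≤ φ x) {x : X} (hx : x ∈ Q) : sInf (φ '' Q) ≤ φ x :=
  csInf_le ⟨0, by rintro _ ⟨y, -, rfl⟩; exact hφ y⟩ (mem_image_of_mem _ hx)

theorem valueFun_le (hφ : ∀ x, 0 ≤ φ x) (hψ : ∀ i x, 0 ≤ ψ i x) {η : Fin n → ℝ}
    (hη : ∀ i, 0 ≤ η i) {x : X} (hx : x ∈ Q) :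
    valueFun Q φ ψ η ≤ φ x + ∑ i, η i * ψ i x := by
  refine csInf_le ⟨0, ?_⟩ (mem_image_of_mem _ hx)
  rintro _ ⟨y, -, rfl⟩
  exact add_nonneg (hφ y) (Finset.sum_nonneg fun i _ => mul_nonneg (hη i) (hψ i y))

theorem le_valueFun (hQ : Q.Nonempty) {η : Fin n → ℝ} {c : ℝ}
    (h : ∀ x ∈ Q, c ≤ φ x + ∑ i, η i * ψ i x) : c ≤ valueFun Q φ ψ η := by
  refine le_csInf (hQ.image _) ?_
  rintro _ ⟨y, hy, rfl⟩
  exact h y hy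

theorem sInf_fidelity_le_valueFun (hQ : Q.Nonempty) (hφ : ∀ x, 0 ≤ φ x)
    (hψ : ∀ i x, 0 ≤ ψ i x) {η : Fin n → ℝ} (hη : ∀ i, 0 ≤ η i) :
    sInf (φ '' Q) ≤ valueFun Q φ ψ η :=
  le_valueFun hQ fun x hx => (sInf_fidelity_le hφ hx).trans <|
    le_add_of_nonneg_right (Finset.sum_nonneg fun i _ => mul_nonneg (hη i) (hψ i x))

theorem valueFun_mono (hQ : Q.Nonempty) (hφ : ∀ x, 0 ≤ φ x) (hψ : ∀ i x, 0 ≤ ψ i x)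
    {η ζ : Fin n → ℝ} (hη : ∀ i, 0 ≤ η i) (h : η ≤ ζ) :
    valueFun Q φ ψ η ≤ valueFun Q φ ψ ζ :=
  le_valueFun hQ fun x hx => (valueFun_le hφ hψ hη hx).trans <|
    add_le_add_right
      (Finset.sum_le_sum fun i _ => mul_le_mul_of_nonneg_right (h i) (hψ i x)) _

theorem tendsto_valueFun (hQ : Q.Nonempty) (hφ : ∀ x, 0 ≤ φ x) (hψ : ∀ i x, 0 ≤ ψ i x) :
    Tendsto (valueFun Q φ ψ) (𝓝[{η : Fin n → ℝ | ∀ i, 0 < η i}] 0) (𝓝 (sInf (φ '' Q))) := by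
  refine tendsto_order.2 ⟨fun a ha => ?_, fun a ha => ?_⟩
  · filter_upwards [self_mem_nhdsWithin] with η hη
    exact ha.trans_le (sInf_fidelity_le_valueFun hQ hφ hψ fun i => (hη i).le)
  · obtain ⟨_, ⟨x, hx, rfl⟩, hxa⟩ := exists_lt_of_csInf_lt (hQ.image φ) ha
    have hcont : Continuous fun η : Fin n → ℝ => φ x + ∑ i, η i * ψ i x := by fun_prop
    have hlim : ∀ᶠ η in 𝓝 (0 : Fin n → ℝ), φ x + ∑ i, η i * ψ i x < a :=
      hcont.continuousAt.eventually_lt continuousAt_const (by simpa using hxa)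
    filter_upwards [self_mem_nhdsWithin, hlim.filter_mono nhdsWithin_le_nhds] with η hη hηa
    exact (valueFun_le hφ hψ (fun i => (hη i).le) hx).trans_lt hηa

theorem sub_smul_single_nonneg {ζ : Fin n → ℝ} (hζ : ∀ j, 0 ≤ ζ j) {i : Fin n} {h : ℝ}
    (hi : h ≤ ζ i) (j : Fin n) : 0 ≤ (ζ - h • (Pi.single i 1 : Fin n → ℝ)) j := by
  rcases eq_or_ne j i with rfl | hj
  · simpa using hi
  · simpa [hj] using hζ j

theorem smul_single_nonneg (i : Fin n) {h : ℝ} (hh : 0 ≤ h) :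
    0 ≤ h • (Pi.single i 1 : Fin n → ℝ) :=
  smul_nonneg hh (Pi.single_nonneg.2 zero_le_one)

/-- Concavity of the value function along a coordinate direction, with the endpoint on the face
`ζ i = 0` bounded below by the infimum of the fidelity. -/
theorem mul_valueFun_sub_le (hQ : Q.Nonempty) (hφ : ∀ x, 0 ≤ φ x) (hψ : ∀ i x, 0 ≤ ψ i x)
    {ζ : Fin n → ℝ} (hζ : ∀ j, 0 ≤ ζ j) {i : Fin n} {h : ℝ} (hh : 0 ≤ h) (hi : h ≤ ζ i)
    (hpos : 0 < ζ i) :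
    ζ i * (valueFun Q φ ψ ζ - valueFun Q φ ψ (ζ - h • (Pi.single i 1 : Fin n → ℝ))) ≤
      h * (valueFun Q φ ψ ζ - sInf (φ '' Q)) := by
  have key : ((ζ i - h) * valueFun Q φ ψ ζ + h * sInf (φ '' Q)) / ζ i ≤
      valueFun Q φ ψ (ζ - h • (Pi.single i 1 : Fin n → ℝ)) := by
    refine le_valueFun hQ fun x hx => ?_
    have hsum : ∑ j, (ζ - h • (Pi.single i 1 : Fin n → ℝ)) j * ψ j x =
        ∑ j, ζ j * ψ j x - h * ψ i x := by
      simp [sub_mul, Finset.sum_sub_distrib, Pi.single_apply]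
    have hterm : ζ i * ψ i x ≤ ∑ j, ζ j * ψ j x :=
      Finset.single_le_sum (f := fun j => ζ j * ψ j x)
        (fun j _ => mul_nonneg (hζ j) (hψ j x)) (Finset.mem_univ i)
    rw [hsum, div_le_iff₀ hpos]
    have hval := mul_le_mul_of_nonneg_left (valueFun_le hφ hψ hζ hx) (sub_nonneg.2 hi)
    have hinf := mul_le_mul_of_nonneg_left (sInf_fidelity_le hφ hx) hh
    have hpen := mul_le_mul_of_nonneg_left hterm hh
    linarith
  rw [div_le_iff₀ hpos] at key
  linarith

theorem HasDMinus.mul_mem_Icc (hQ : Q.Nonempty) (hφ : ∀ x, 0 ≤ φ x) (hψ : ∀ i x, 0 ≤ ψ i x)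
    {η : Fin n → ℝ} (hη : ∀ j, 0 < η j) {i : Fin n} {D : ℝ}
    (hD : HasDMinus (valueFun Q φ ψ) η i D) :
    η i * D ∈ Icc 0 (valueFun Q φ ψ η - sInf (φ '' Q)) := by
  refine isClosed_Icc.mem_of_tendsto (hD.const_mul (η i)) ?_
  filter_upwards [Ioo_mem_nhdsGT (hη i)] with h ⟨hh, hi⟩
  have hnonneg : ∀ j, 0 ≤ η j := fun j => (hη j).le
  have hmono := valueFun_mono hQ hφ hψ (sub_smul_single_nonneg hnonneg hi.le)
    (sub_le_self η (smul_single_nonneg i hh.le))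
  refine ⟨mul_nonneg (hnonneg i) (div_nonneg (sub_nonneg.2 hmono) hh.le), ?_⟩
  rw [← mul_div_assoc, div_le_iff₀' hh]
  exact mul_valueFun_sub_le hQ hφ hψ hnonneg hh.le hi.le (hη i)

theorem HasDPlus.mul_mem_Icc (hQ : Q.Nonempty) (hφ : ∀ x, 0 ≤ φ x) (hψ : ∀ i x, 0 ≤ ψ i x)
    {η : Fin n → ℝ} (hη : ∀ j, 0 < η j) {i : Fin n} {D : ℝ}
    (hD : HasDPlus (valueFun Q φ ψ) η i D) :
    η i * D ∈ Icc 0 (valueFun Q φ ψ η - sInf (φ '' Q)) := by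
  refine isClosed_Icc.mem_of_tendsto (hD.const_mul (η i)) ?_
  filter_upwards [self_mem_nhdsWithin] with h (hh : 0 < h)
  have hnonneg : ∀ j, 0 ≤ η j := fun j => (hη j).le
  have hle : η ≤ η + h • (Pi.single i 1 : Fin n → ℝ) :=
    le_add_of_nonneg_right (smul_single_nonneg i hh.le)
  have hmono := valueFun_mono hQ hφ hψ hnonneg hle
  refine ⟨mul_nonneg (hnonneg i) (div_nonneg (sub_nonneg.2 hmono) hh.le), ?_⟩
  rw [← mul_div_assoc, div_le_iff₀' hh]
  have hi : (η + h • (Pi.single i 1 : Fin n → ℝ)) i = η i + h := by simp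
  have hconc := mul_valueFun_sub_le hQ hφ hψ (fun j => (hnonneg j).trans (hle j)) hh.le
    (by rw [hi]; linarith [hη i]) ((hη i).trans_le (hle i))
  rw [hi, add_sub_cancel_right] at hconc
  linarith

end ValueFun

/-- as `η → 0` within the positive orthant, `F(η) → inf_{x ∈ Q} φ(x)`,
and for each `i` both `η_i ∂_i⁻F(η) → 0` and `η_i ∂_i⁺F(η) → 0`. -/
theorem valueFun_asymptotics {X : Type*} {n : ℕ} (Q : Set X) (hQ : Q.Nonempty)
    (φ : X → ℝ) (hφ : ∀ x, 0 ≤ φ x)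
    (ψ : Fin n → X → ℝ) (hψ : ∀ i x, 0 ≤ ψ i x) :
    Filter.Tendsto (fun η => valueFun Q φ ψ η)
      (nhdsWithin 0 {η : Fin n → ℝ | ∀ i, 0 < η i}) (nhds (sInf (φ '' Q))) ∧
    ∀ (i : Fin n) (Dm Dp : (Fin n → ℝ) → ℝ),
      (∀ η : Fin n → ℝ, (∀ j, 0 < η j) → HasDMinus (valueFun Q φ ψ) η i (Dm η)) →
      (∀ η : Fin n → ℝ, (∀ j, 0 < η j) → HasDPlus (valueFun Q φ ψ) η i (Dp η)) →
      Filter.Tendsto (fun η : Fin n → ℝ => η i * Dm η)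
        (nhdsWithin 0 {η : Fin n → ℝ | ∀ i, 0 < η i}) (nhds 0) ∧
      Filter.Tendsto (fun η : Fin n → ℝ => η i * Dp η)
        (nhdsWithin 0 {η : Fin n → ℝ | ∀ i, 0 < η i}) (nhds 0) := by
  refine ⟨tendsto_valueFun hQ hφ hψ, fun i Dm Dp hm hp => ?_⟩
  have hgap : Tendsto (fun η => valueFun Q φ ψ η - sInf (φ '' Q))
      (𝓝[{η : Fin n → ℝ | ∀ i, 0 < η i}] 0) (𝓝 0) := by
    simpa using (tendsto_valueFun hQ hφ hψ).sub_const (sInf (φ '' Q))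
  constructor
  · refine squeeze_zero' ?_ ?_ hgap <;> filter_upwards [self_mem_nhdsWithin] with η hη
    exacts [((hm η hη).mul_mem_Icc hQ hφ hψ hη).1, ((hm η hη).mul_mem_Icc hQ hφ hψ hη).2]
  · refine squeeze_zero' ?_ ?_ hgap <;> filter_upwards [self_mem_nhdsWithin] with η hη
    exacts [((hp η hη).mul_mem_Icc hQ hφ hψ hη).1, ((hp η hη).mul_mem_Icc hQ hφ hψ hη).2]
end
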